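/- Let (X,λ) and (Y,λ') be AS.R. spaces. If there exists an asymptotic equivalence f : X → Y, then for every natural number n, asdim_λ X ≤ n if and only if asdim_{λ'} Y ≤ n; in particular asymptotically equivalent AS.R. spaces have the same asymptotic dimension. -/

import Mathlib

/-- An *asymptotic resemblance* (AS.R.): an equivalence relation on the power set
satisfying the union and splitting axioms. -/
structure IsASR {X : Type*} (l : Set X → Set X → Prop) : Prop where
  equiv : Equivalence l
  union : ∀ ⦃A₁ B₁ A₂ B₂ : Set X⦄, l A₁ B₁ → l A₂ B₂ → l (A₁ ∪ A₂) (B₁ ∪ B₂)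
  split : ∀ ⦃B₁ B₂ A : Set X⦄, l (B₁ ∪ B₂) A → B₁.Nonempty → B₂.Nonempty →
    ∃ A₁ A₂ : Set X, A₁.Nonempty ∧ A₂.Nonempty ∧ A = A₁ ∪ A₂ ∧ l B₁ A₁ ∧ l B₂ A₂

/-- A subset of an AS.R. space is *bounded* if it is empty or asymptotically alike to a
singleton. -/
def ASRBounded {X : Type*} (l : Set X → Set X → Prop) (A : Set X) : Prop :=
  A = ∅ ∨ ∃ x : X, l A {x}

/-- `E(A) = {y | ∃ x ∈ A, (x, y) ∈ E}`. -/
def entImage {X : Type*} (e : Set (X × X)) (A : Set X) : Set X :=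
  {y : X | ∃ x ∈ A, (x, y) ∈ e}

/-- `S_𝒰 = ⋃_{U ∈ 𝒰} U × U`. -/
def SU {X : Type*} (U : Set (Set X)) : Set (X × X) :=
  ⋃ u ∈ U, u ×ˢ u

/-- `A ∼_𝒰 B` iff `A ⊆ S_𝒰(B)` and `B ⊆ S_𝒰(A)`. -/
def simU {X : Type*} (U : Set (Set X)) (A B : Set X) : Prop :=
  A ⊆ entImage (SU U) B ∧ B ⊆ entImage (SU U) A

/-- A family `𝒰` of subsets of an AS.R. space `(X, l)` is *uniformly bounded* if every
member is bounded and `A ∼_𝒰 B` implies `A λ B`. -/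
def UnifBoundedASR {X : Type*} (l : Set X → Set X → Prop) (U : Set (Set X)) : Prop :=
  (∀ u ∈ U, ASRBounded l u) ∧ ∀ A B : Set X, simU U A B → l A B

/-- `μ(𝒱) ≤ m`: at most `m` members of `𝒱` meet any given point. -/
def MultiplicityLE {X : Type*} (V : Set (Set X)) (m : ℕ) : Prop :=
  ∀ (x : X) (S : Finset (Set X)), (↑S : Set (Set X)) ⊆ {v ∈ V | x ∈ v} → S.card ≤ m

/-- `𝒰` refines `𝒱`: every member of `𝒰` is contained in some member of `𝒱`. -/
def Refines {X : Type*} (U V : Set (Set X)) : Prop :=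
  ∀ u ∈ U, ∃ v ∈ V, u ⊆ v

/-- `asdim_l X ≤ n`: every uniformly bounded cover `𝒰` of `X` refines some uniformly
bounded cover `𝒱` of `X` of multiplicity at most `n + 1`. -/
def AsdimLE {X : Type*} (l : Set X → Set X → Prop) (n : ℕ) : Prop :=
  ∀ U : Set (Set X), UnifBoundedASR l U → ⋃₀ U = Set.univ →
    ∃ V : Set (Set X), UnifBoundedASR l V ∧ ⋃₀ V = Set.univ ∧
      Refines U V ∧ MultiplicityLE V (n + 1)


/-- `f : X → Y` is an *AS.R. mapping* if preimages of bounded sets are bounded and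
`A λ₁ B` implies `f(A) λ₂ f(B)`. -/
def ASRMapping {X Y : Type*} (l₁ : Set X → Set X → Prop) (l₂ : Set Y → Set Y → Prop)
    (f : X → Y) : Prop :=
  (∀ B : Set Y, ASRBounded l₂ B → ASRBounded l₁ (f ⁻¹' B)) ∧
  ∀ A B : Set X, l₁ A B → l₂ (f '' A) (f '' B)

/-- Two maps `f g : X → Y` into an AS.R. space `(Y, l₂)` are *close* if
`f(A) λ₂ g(A)` for every subset `A` of `X`. -/
def CloseMaps {X Y : Type*} (l₂ : Set Y → Set Y → Prop) (f g : X → Y) : Prop :=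
  ∀ A : Set X, l₂ (f '' A) (g '' A)

/-- An AS.R. mapping `f : X → Y` is an *asymptotic equivalence* if there is an AS.R.
mapping `g : Y → X` with `g ∘ f` close to `id X` and `f ∘ g` close to `id Y`. -/
def AsympEquivMap {X Y : Type*} (l₁ : Set X → Set X → Prop) (l₂ : Set Y → Set Y → Prop)
    (f : X → Y) : Prop :=
  ASRMapping l₁ l₂ f ∧ ∃ g : Y → X, ASRMapping l₂ l₁ g ∧
    CloseMaps l₁ (g ∘ f) id ∧ CloseMaps l₂ (f ∘ g) id

lemma mem_entImage_SU {X : Type*} {U : Set (Set X)} {A : Set X} {y : X} :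
    y ∈ entImage (SU U) A ↔ ∃ x ∈ A, ∃ u ∈ U, x ∈ u ∧ y ∈ u := by
  simp [entImage, SU, and_left_comm]

lemma ASRMapping.bounded_image {X Y : Type*} {l : Set X → Set X → Prop}
    {l' : Set Y → Set Y → Prop} {f : X → Y} (hf : ASRMapping l l' f) {A : Set X}
    (hA : ASRBounded l A) : ASRBounded l' (f '' A) := by
  rcases hA with rfl | ⟨x, hx⟩
  · exact Or.inl (Set.image_empty f)
  · exact Or.inr ⟨f x, by simpa using hf.2 _ _ hx⟩

/-- The images of a uniformly bounded family under an AS.R. mapping, together with all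
singletons, form a uniformly bounded family. -/
lemma UnifBoundedASR.image_union_singletons {X Y : Type*} {l : Set X → Set X → Prop}
    {l' : Set Y → Set Y → Prop} (hl' : IsASR l') {f : X → Y} (hf : ASRMapping l l' f)
    {U : Set (Set X)} (hU : UnifBoundedASR l U) :
    UnifBoundedASR l' (Set.image f '' U ∪ Set.range (fun y : Y => ({y} : Set Y))) := by
  refine ⟨?_, fun A B ⟨hAB, hBA⟩ => ?_⟩
  · rintro _ (⟨u, hu, rfl⟩ | ⟨y, rfl⟩)
    · exact hf.bounded_image (hU.1 u hu)
    · exact Or.inr ⟨y, hl'.equiv.refl _⟩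
  · let P : Set X := {x | f x ∈ A ∧ ∃ z, f z ∈ B ∧ ∃ u ∈ U, x ∈ u ∧ z ∈ u}
    let Q : Set X := {z | f z ∈ B ∧ ∃ x, f x ∈ A ∧ ∃ u ∈ U, x ∈ u ∧ z ∈ u}
    have hPQ : l P Q := by
      refine hU.2 P Q ⟨?_, ?_⟩
      · rintro x ⟨hx, z, hz, u, hu, hxu, hzu⟩
        exact mem_entImage_SU.2 ⟨z, ⟨hz, x, hx, u, hu, hxu, hzu⟩, u, hu, hzu, hxu⟩
      · rintro z ⟨hz, x, hx, u, hu, hxu, hzu⟩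
        exact mem_entImage_SU.2 ⟨x, ⟨hx, z, hz, u, hu, hxu, hzu⟩, u, hu, hxu, hzu⟩
    have hA : f '' P ∪ A ∩ B = A := by
      refine Set.Subset.antisymm ?_ fun a ha => ?_
      · rintro _ (⟨x, hx, rfl⟩ | h)
        exacts [hx.1, h.1]
      · obtain ⟨b, hb, w, ⟨u, hu, rfl⟩ | ⟨y, rfl⟩, hbw, haw⟩ := mem_entImage_SU.1 (hAB ha)
        · obtain ⟨z, hzu, rfl⟩ := hbw
          obtain ⟨x, hxu, rfl⟩ := haw
          exact Or.inl ⟨x, ⟨ha, z, hb, u, hu, hxu, hzu⟩, rfl⟩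
        · obtain rfl : b = y := hbw
          obtain rfl : a = b := haw
          exact Or.inr ⟨ha, hb⟩
    have hB : f '' Q ∪ A ∩ B = B := by
      refine Set.Subset.antisymm ?_ fun b hb => ?_
      · rintro _ (⟨z, hz, rfl⟩ | h)
        exacts [hz.1, h.2]
      · obtain ⟨a, ha, w, ⟨u, hu, rfl⟩ | ⟨y, rfl⟩, haw, hbw⟩ := mem_entImage_SU.1 (hBA hb)
        · obtain ⟨z, hzu, rfl⟩ := hbw
          obtain ⟨x, hxu, rfl⟩ := haw
          exact Or.inl ⟨z, ⟨hb, x, ha, u, hu, hxu, hzu⟩, rfl⟩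
        · obtain rfl : a = y := haw
          obtain rfl : b = a := hbw
          exact Or.inr ⟨ha, hb⟩
    have h := hl'.union (hf.2 _ _ hPQ) (hl'.equiv.refl (A ∩ B))
    rwa [hA, hB] at h

/-- Preimages of a uniformly bounded family under an AS.R. mapping with a left inverse up to
closeness form a uniformly bounded family. -/
lemma UnifBoundedASR.preimage {X Y : Type*} {l : Set X → Set X → Prop}
    {l' : Set Y → Set Y → Prop} (hl : IsASR l) {f : X → Y} {g : Y → X}
    (hf : ASRMapping l l' f) (hg : ASRMapping l' l g) (hgf : CloseMaps l (g ∘ f) id)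
    {V : Set (Set Y)} (hV : UnifBoundedASR l' V) :
    UnifBoundedASR l (Set.preimage f '' V) := by
  have key : ∀ A B : Set X, A ⊆ entImage (SU (Set.preimage f '' V)) B →
      f '' A ⊆ entImage (SU V) (f '' B) := by
    rintro A B h _ ⟨a, ha, rfl⟩
    obtain ⟨b, hb, _, ⟨v, hv, rfl⟩, hbv, hav⟩ := mem_entImage_SU.1 (h ha)
    exact mem_entImage_SU.2 ⟨f b, ⟨b, hb, rfl⟩, v, hv, hbv, hav⟩
  refine ⟨?_, fun A B ⟨hAB, hBA⟩ => ?_⟩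
  · rintro _ ⟨v, hv, rfl⟩
    exact hf.1 v (hV.1 v hv)
  · have h := hg.2 _ _ (hV.2 _ _ ⟨key A B hAB, key B A hBA⟩)
    have hA := hgf A
    have hB := hgf B
    rw [Set.image_comp, Set.image_id] at hA hB
    exact hl.equiv.trans (hl.equiv.symm hA) (hl.equiv.trans h hB)

lemma MultiplicityLE.preimage {X Y : Type*} (f : X → Y) {V : Set (Set Y)} {m : ℕ}
    (hV : MultiplicityLE V m) : MultiplicityLE (Set.preimage f '' V) m := by
  classical
  intro x S hS
  obtain ⟨T, hT, rfl⟩ : ∃ T : Finset (Set Y), (T : Set (Set Y)) ⊆ {v ∈ V | f x ∈ v} ∧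
      T.image (Set.preimage f) = S := by
    refine Finset.subset_set_image_iff.1 fun s hs => ?_
    obtain ⟨⟨v, hv, rfl⟩, hx⟩ := hS hs
    exact ⟨v, ⟨hv, hx⟩, rfl⟩
  exact Finset.card_image_le.trans (hV (f x) T hT)

/-- The asymptotic dimension bound pulls back along an AS.R. mapping with a left inverse up
to closeness. -/
lemma AsdimLE.of_leftInverse {X Y : Type*} {l : Set X → Set X → Prop}
    {l' : Set Y → Set Y → Prop} (hl : IsASR l) (hl' : IsASR l') {f : X → Y} {g : Y → X}
    (hf : ASRMapping l l' f) (hg : ASRMapping l' l g) (hgf : CloseMaps l (g ∘ f) id)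
    {n : ℕ} (h : AsdimLE l' n) : AsdimLE l n := by
  intro U hU _
  obtain ⟨V, hV, hcov, href, hmul⟩ := h _ (hU.image_union_singletons hl' hf)
    (Set.eq_univ_of_forall fun y => ⟨{y}, Or.inr ⟨y, rfl⟩, rfl⟩)
  refine ⟨Set.preimage f '' V, hV.preimage hl hf hg hgf, ?_, fun u hu => ?_, hmul.preimage f⟩
  · refine Set.eq_univ_of_forall fun x => ?_
    obtain ⟨v, hv, hx⟩ : f x ∈ ⋃₀ V := hcov ▸ Set.mem_univ _
    exact ⟨f ⁻¹' v, ⟨v, hv, rfl⟩, hx⟩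
  · obtain ⟨v, hv, huv⟩ := href _ (Or.inl ⟨u, hu, rfl⟩)
    exact ⟨f ⁻¹' v, ⟨v, hv, rfl⟩, Set.image_subset_iff.1 huv⟩

/-- Asymptotically equivalent AS.R. spaces have the same asymptotic dimension: if
`f : X → Y` is an asymptotic equivalence then for every `n`, `asdim X ≤ n ↔ asdim Y ≤ n`. -/
theorem stmt_16 {X Y : Type*} (l : Set X → Set X → Prop) (l' : Set Y → Set Y → Prop)
    (hl : IsASR l) (hl' : IsASR l') (f : X → Y) (hf : AsympEquivMap l l' f) (n : ℕ) :
    AsdimLE l n ↔ AsdimLE l' n := by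
  obtain ⟨hf, g, hg, hgf, hfg⟩ := hf
  exact ⟨.of_leftInverse hl' hl hg hf hfg, .of_leftInverse hl hl' hf hg hgf⟩
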